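/- arXiv:2512.08317 — 3 statements merged into one kernel-verified Lean document; each statement's English description precedes it below -/
import Mathlib

section
/- For all real numbers a, b and every real c with −1 ≤ c ≤ 1: cosh a · cosh b − sinh a · sinh b · c ≥ (1/4) · e^(a+b) · (1 − c). -/
theorem law_of_cosines_exp_lower_bound (a b c : ℝ) (hc1 : -1 ≤ c) (hc2 : c ≤ 1) :
    Real.cosh a * Real.cosh b - Real.sinh a * Real.sinh b * c ≥
      (1 / 4) * Real.exp (a + b) * (1 - c) := by
  rw [Real.cosh_eq, Real.cosh_eq, Real.sinh_eq, Real.sinh_eq, Real.exp_add]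
  have h1 : 0 ≤ Real.exp (-a) * Real.exp (-b) * (1 - c) :=
    mul_nonneg (by positivity) (by linarith)
  have h2 : 0 ≤ (Real.exp a * Real.exp (-b) + Real.exp (-a) * Real.exp b) * (1 + c) :=
    mul_nonneg (by positivity) (by linarith)
  nlinarith [h1, h2]
end

section
/- Let D ≥ 0, let a, b be real numbers, and let θ ∈ (0, π]. If cosh D = cosh a · cosh b − sinh a · sinh b · cos θ and e^(a+b) · θ² ≥ 2π², then D ≥ a + b + 2·log θ − log(2π²). -/
theorem lower_quasi_isometry_bound (D a b θ : ℝ) (hD : 0 ≤ D)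
    (hθ0 : 0 < θ) (hθπ : θ ≤ Real.pi)
    (hlaw : Real.cosh D = Real.cosh a * Real.cosh b - Real.sinh a * Real.sinh b * Real.cos θ)
    (hbig : Real.exp (a + b) * θ ^ 2 ≥ 2 * Real.pi ^ 2) :
    D ≥ a + b + 2 * Real.log θ - Real.log (2 * Real.pi ^ 2) := by
  have hpi := Real.pi_pos
  have hc : Real.cos θ ≤ 1 - 2 / Real.pi ^ 2 * θ ^ 2 :=
    Real.cos_le_one_sub_mul_cos_sq (abs_le.2 ⟨by linarith, hθπ⟩)
  have h1 : Real.cosh D = Real.cosh (a + b) * (1 - Real.cos θ) / 2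
      + Real.cosh (a - b) * (1 + Real.cos θ) / 2 := by
    rw [hlaw, Real.cosh_add, Real.cosh_sub]; ring
  have h2 : 0 ≤ Real.cosh (a - b) * (1 + Real.cos θ) :=
    mul_nonneg (Real.cosh_pos _).le (by linarith [Real.neg_one_le_cos θ])
  have h3 : Real.exp (a + b) / 2 ≤ Real.cosh (a + b) := by
    rw [Real.cosh_eq]; linarith [Real.exp_pos (-(a + b))]
  have h4 : Real.exp (a + b) / 2 * (2 / Real.pi ^ 2 * θ ^ 2)
      ≤ Real.cosh (a + b) * (1 - Real.cos θ) :=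
    mul_le_mul h3 (by linarith) (by positivity) (Real.cosh_pos _).le
  have h5 : Real.cosh D ≤ Real.exp D := by
    have : Real.exp (-D) ≤ Real.exp D := Real.exp_le_exp.2 (by linarith)
    rw [Real.cosh_eq]; linarith
  have h6 : Real.exp (a + b) * θ ^ 2 / (2 * Real.pi ^ 2) ≤ Real.exp D := by
    have : Real.exp (a + b) * θ ^ 2 / (2 * Real.pi ^ 2)
        = Real.exp (a + b) / 2 * (2 / Real.pi ^ 2 * θ ^ 2) / 2 := by
      field_simp
    linarith
  have h7 := Real.log_le_log (by positivity) h6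
  rw [Real.log_exp, Real.log_div (by positivity) (by positivity),
    Real.log_mul (by positivity) (by positivity), Real.log_exp, Real.log_pow] at h7
  push_cast at h7
  linarith
end

section
/- Let (X, d) be a metric space, o ∈ X, R > 0, and m ≥ 1. Let f : X → EuclideanSpace ℝ (Fin m) be β-Lipschitz for some β > 0, i.e., ‖f(x) − f(y)‖ ≤ β · d(x, y) for all x, y ∈ X. Let Δ > 0, C₁ > 0, γ > 0, and let S be a finite subset of the closed ball of radius R around o such that ‖f(u) − f(v)‖ ≥ Δ for all distinct u, v ∈ S and |S| ≥ C₁ · e^(γR). Then β ≥ (Δ/(2R)) · (C₁^(1/m) · e^(γR/m) − 1). -/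
open MeasureTheory Metric Module in
theorem card_packing_bound {X : Type*} {m : ℕ} (f : X → EuclideanSpace ℝ (Fin m))
    (p : EuclideanSpace ℝ (Fin m)) (S : Finset X) (δ r : ℝ) (hδ : 0 < δ) (hr : 0 < r)
    (hs : ∀ c ∈ S, dist (f c) p ≤ r)
    (h : ∀ c ∈ S, ∀ d ∈ S, c ≠ d → δ + δ ≤ ‖f c - f d‖) :
    (S.card : ℝ) * δ ^ m ≤ (δ + r) ^ m := by
  let μ : Measure (EuclideanSpace ℝ (Fin m)) := volume
  have ρpos : 0 < δ + r := by positivity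
  have D : Set.Pairwise (S : Set X) (Function.onFun Disjoint fun c => ball (f c) δ) := by
    rintro c hc d hd hcd
    apply ball_disjoint_ball
    rw [dist_eq_norm]
    exact h c hc d hd hcd
  have A_subset : (⋃ c ∈ S, ball (f c) δ) ⊆ ball p (δ + r) := by
    refine Set.iUnion₂_subset fun x hx => ?_
    apply ball_subset_ball'
    linarith [hs x hx]
  have I : (S.card : ENNReal) * ENNReal.ofReal (δ ^ m) * μ (ball 0 1) ≤
      ENNReal.ofReal ((δ + r) ^ m) * μ (ball 0 1) :=
    calc
      (S.card : ENNReal) * ENNReal.ofReal (δ ^ m) * μ (ball 0 1)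
          = μ (⋃ c ∈ S, ball (f c) δ) := by
        rw [measure_biUnion_finset D fun c _ => measurableSet_ball]
        simp only [μ.addHaar_ball_of_pos _ hδ, finrank_euclideanSpace_fin]
        simp only [Finset.sum_const, nsmul_eq_mul, mul_assoc]
      _ ≤ μ (ball p (δ + r)) := measure_mono A_subset
      _ = ENNReal.ofReal ((δ + r) ^ m) * μ (ball 0 1) := by
        simp only [μ.addHaar_ball_of_pos _ ρpos, finrank_euclideanSpace_fin]
  have J : (S.card : ENNReal) * ENNReal.ofReal (δ ^ m) ≤ ENNReal.ofReal ((δ + r) ^ m) :=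
    (ENNReal.mul_le_mul_iff_left (measure_ball_pos _ _ zero_lt_one).ne' measure_ball_lt_top.ne).1 I
  have := ENNReal.toReal_le_of_le_ofReal (pow_nonneg ρpos.le _) J
  rwa [ENNReal.toReal_mul, ENNReal.toReal_natCast,
    ENNReal.toReal_ofReal (pow_nonneg hδ.le _)] at this


theorem lipschitz_lower_bound_strong_noncollapse
    {X : Type*} [MetricSpace X] (o : X) (R : ℝ) (hR : 0 < R)
    (m : ℕ) (hm : 1 ≤ m) (f : X → EuclideanSpace ℝ (Fin m))
    (β : ℝ) (hβ : 0 < β)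
    (hf : ∀ x y : X, ‖f x - f y‖ ≤ β * dist x y)
    (Δ C₁ γ : ℝ) (hΔ : 0 < Δ) (hC₁ : 0 < C₁) (hγ : 0 < γ)
    (S : Finset X)
    (hball : ∀ x ∈ S, dist x o ≤ R)
    (hsep : ∀ u ∈ S, ∀ v ∈ S, u ≠ v → ‖f u - f v‖ ≥ Δ)
    (hcard : (S.card : ℝ) ≥ C₁ * Real.exp (γ * R)) :
    β ≥ (Δ / (2 * R)) * (C₁ ^ ((1 : ℝ) / m) * Real.exp (γ * R / m) - 1) := by

  have hm0 : m ≠ 0 := by omega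
  have hmR : (m : ℝ) ≠ 0 := by exact_mod_cast hm0
  have h1 := card_packing_bound f (f o) S (Δ / 2) (β * R) (by positivity) (by positivity)
    (fun c hc => by
      rw [dist_eq_norm]
      exact (hf c o).trans (mul_le_mul_of_nonneg_left (hball c hc) hβ.le))
    (fun c hc d hd hcd => by
      have := hsep c hc d hd hcd
      linarith)
  set a : ℝ := C₁ ^ ((1 : ℝ) / m) * Real.exp (γ * R / m) with ha
  have ham : a ^ m = C₁ * Real.exp (γ * R) := by
    rw [ha, mul_pow, one_div, Real.rpow_inv_natCast_pow hC₁.le hm0, ← Real.exp_nat_mul]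
    congr 2
    field_simp
  have h2 : (a * (Δ / 2)) ^ m ≤ (Δ / 2 + β * R) ^ m := by
    rw [mul_pow, ham]
    exact (mul_le_mul_of_nonneg_right hcard (by positivity)).trans h1
  have h3 : a * (Δ / 2) ≤ Δ / 2 + β * R := le_of_pow_le_pow_left₀ hm0 (by positivity) h2
  rw [ge_iff_le, div_mul_eq_mul_div, div_le_iff₀ (by positivity)]
  nlinarith [h3]
end
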